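/- arXiv:2207.13476 — 5 statements merged into one kernel-verified Lean document; each statement's English description precedes it below -/
import Mathlib

section
/- Let φ : K → ℝ be a convex function attaining its minimum value at 0. Then for all x, y ∈ K, |x| ≤ |y| implies φ(x) ≤ φ(y). -/
open Pointwise Filter

/-- `A` is absolutely convex: a module over the closed unit ball `B_K` of `K`,
i.e. `0 ∈ A`, `A` is closed under addition and under scalar multiplication by
scalars of norm at most `1`. -/
def AbsolutelyConvex (K : Type*) {E : Type*} [NormedField K] [AddCommGroup E] [Module K E]
    (A : Set E) : Prop :=
  0 ∈ A ∧ (∀ x ∈ A, ∀ y ∈ A, x + y ∈ A) ∧ ∀ c : K, ‖c‖ ≤ 1 → ∀ x ∈ A, c • x ∈ A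

/-- A set is convex if it is a translate of an absolutely convex set. -/
def KConvex (K : Type*) {E : Type*} [NormedField K] [AddCommGroup E] [Module K E]
    (C : Set E) : Prop :=
  ∃ (x : E) (A : Set E), AbsolutelyConvex K A ∧ C = (fun a => x + a) '' A

/-- A convex filter on `A`: a (proper) filter containing `A` with a base of
convex subsets of `A`. -/
def IsConvexFilter (K : Type*) {E : Type*} [NormedField K] [AddCommGroup E] [Module K E]
    (A : Set E) (F : Filter E) : Prop :=
  F.NeBot ∧ A ∈ F ∧ ∀ S ∈ F, ∃ C ∈ F, C ⊆ S ∧ C ⊆ A ∧ KConvex K C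

/-- A maximal convex filter on `A`. -/
def IsMaximalConvexFilter (K : Type*) {E : Type*} [NormedField K] [AddCommGroup E]
    [Module K E] (A : Set E) (F : Filter E) : Prop :=
  IsConvexFilter K A F ∧ ∀ G : Filter E, IsConvexFilter K A G → G ≤ F → G = F

/-- `A` is c-compact: every family of (relatively) closed convex subsets of `A`
with the finite intersection property has nonempty intersection. -/
def IsCCompact (K : Type*) {E : Type*} [NormedField K] [AddCommGroup E] [Module K E]
    [TopologicalSpace E] (A : Set E) : Prop :=
  ∀ 𝒞 : Set (Set E),
    (∀ C ∈ 𝒞, C ⊆ A ∧ IsClosed ((Subtype.val ⁻¹' C : Set A)) ∧ KConvex K C) →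
    (∀ 𝒟 : Finset (Set E), ↑𝒟 ⊆ 𝒞 → (⋂₀ (𝒟 : Set (Set E))).Nonempty) →
    (⋂₀ 𝒞).Nonempty

/-- `A` is c-precompact: every maximal convex filter on `A` is Cauchy. -/
def IsCPrecompact (K : Type*) {E : Type*} [NormedField K] [AddCommGroup E] [Module K E]
    [UniformSpace E] (A : Set E) : Prop :=
  ∀ F : Filter E, IsMaximalConvexFilter K A F → Cauchy F

/-- The absolutely convex hull of a set: all `B_K`-linear combinations. -/
def acoHull (K : Type*) {E : Type*} [NormedField K] [AddCommGroup E] [Module K E]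
    (S : Set E) : Set E :=
  {x | ∃ (n : ℕ) (c : Fin n → K) (v : Fin n → E),
    (∀ i, ‖c i‖ ≤ 1) ∧ (∀ i, v i ∈ S) ∧ x = ∑ i, c i • v i}

/-- `A` is a compactoid in `E`. -/
def IsCompactoid (K : Type*) {E : Type*} [NormedField K] [AddCommGroup E] [Module K E]
    [TopologicalSpace E] (A : Set E) : Prop :=
  ∀ U ∈ nhds (0 : E), ∃ G : Finset E, A ⊆ U + acoHull K (G : Set E)

/-- `A` is a local compactoid in `E`. -/
def IsLocalCompactoid (K : Type*) {E : Type*} [NormedField K] [AddCommGroup E] [Module K E]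
    [TopologicalSpace E] (A : Set E) : Prop :=
  ∀ U ∈ nhds (0 : E), ∃ S : Finset E,
    A ⊆ U + (Submodule.span K (S : Set E) : Set E)

/-- The topology of `E` is locally convex: there is a neighbourhood base of zero
consisting of absolutely convex sets. -/
def IsLocallyKConvex (K E : Type*) [NormedField K] [AddCommGroup E] [Module K E]
    [TopologicalSpace E] : Prop :=
  ∀ U ∈ nhds (0 : E), ∃ V ∈ nhds (0 : E), V ⊆ U ∧ AbsolutelyConvex K V

/-- `K` is spherically complete: every nonempty nested family of closed balls has
nonempty intersection. -/
def SphericallyComplete (K : Type*) [NormedField K] : Prop :=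
  ∀ S : Set (Set K), S.Nonempty →
    (∀ B ∈ S, ∃ (c : K) (r : ℝ), 0 ≤ r ∧ B = Metric.closedBall c r) →
    IsChain (· ⊆ ·) S → (⋂₀ S).Nonempty

/-- A convex function: `φ (∑ λᵢ xᵢ) ≤ maxᵢ |λᵢ| φ(xᵢ)` whenever `λᵢ ∈ B_K` and
`∑ λᵢ = 1`. -/
def ConvexFun (K : Type*) {E : Type*} [NormedField K] [AddCommGroup E] [Module K E]
    (φ : E → ℝ) : Prop :=
  ∀ (n : ℕ) (x : Fin (n + 1) → E) (lam : Fin (n + 1) → K),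
    (∀ i, ‖lam i‖ ≤ 1) → (∑ i, lam i) = 1 →
    φ (∑ i, lam i • x i) ≤
      Finset.univ.sup' Finset.univ_nonempty fun i => ‖lam i‖ * φ (x i)

/-- `A` is cf-compact: every continuous convex function attains a minimum on `A`. -/
def IsCFCompact (K : Type*) {E : Type*} [NormedField K] [AddCommGroup E] [Module K E]
    [TopologicalSpace E] (A : Set E) : Prop :=
  ∀ φ : E → ℝ, Continuous φ → ConvexFun K φ → ∃ a ∈ A, ∀ x ∈ A, φ a ≤ φ x

/-- `A` is ncf-compact: every continuous non-negative convex function attains a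
minimum on `A`. -/
def IsNCFCompact (K : Type*) {E : Type*} [NormedField K] [AddCommGroup E] [Module K E]
    [TopologicalSpace E] (A : Set E) : Prop :=
  ∀ φ : E → ℝ, Continuous φ → (∀ x, 0 ≤ φ x) → ConvexFun K φ →
    ∃ a ∈ A, ∀ x ∈ A, φ a ≤ φ x

/-- Three-point convexity with all weights of norm one. -/
lemma ConvexFun.three_le {K E : Type*} [NormedField K] [AddCommGroup E] [Module K E]
    {φ : E → ℝ} (hφ : ConvexFun K φ) {a b c : K} (ha : ‖a‖ = 1) (hb : ‖b‖ = 1)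
    (hc : ‖c‖ = 1) (h : a + b + c = 1) {u v w : E} {M : ℝ}
    (hu : φ u ≤ M) (hv : φ v ≤ M) (hw : φ w ≤ M) :
    φ (a • u + b • v + c • w) ≤ M := by
  have key := hφ 2 ![u, v, w] ![a, b, c]
    (by intro i; fin_cases i <;> simp [ha, hb, hc])
    (by simpa [Fin.sum_univ_three] using h)
  rw [Fin.sum_univ_three] at key
  refine le_trans key (Finset.sup'_le _ _ fun i _ => ?_)
  fin_cases i <;> simp [ha, hb, hc, hu, hv, hw]

/-- a convex function on `K` taking its minimum at `0` is monotone in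
the absolute value. -/
theorem statement6 {K : Type*} [NontriviallyNormedField K] [CompleteSpace K]
    [IsUltrametricDist K] (φ : K → ℝ) (hφ : ConvexFun K φ)
    (hmin : ∀ x : K, φ 0 ≤ φ x) :
    ∀ x y : K, ‖x‖ ≤ ‖y‖ → φ x ≤ φ y := by
  intro x y hxy
  rcases eq_or_ne y 0 with rfl | hy
  · simp_all
  obtain ⟨t, rfl⟩ : ∃ t, x = t * y := ⟨x / y, by field_simp⟩
  have ht : ‖t‖ ≤ 1 := by
    rw [norm_mul] at hxy
    exact le_of_mul_le_mul_right (by simpa using hxy) (norm_pos_iff.2 hy)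
  rcases ht.eq_or_lt with ht | ht
  · have h := hφ.three_le ht norm_one ((norm_neg t).trans ht) (by ring)
      (le_refl (φ y)) (hmin y) (hmin y)
    simpa using h
  · have h1 : ‖1 - t‖ = 1 := by
      have h := IsUltrametricDist.norm_add_eq_max_of_norm_ne_norm
        (x := (1 : K)) (y := -t) (by simpa using ht.ne')
      simpa [← sub_eq_add_neg, ht.le] using h
    have h := hφ.three_le ((norm_sub_rev t 1).trans h1) norm_one h1 (by ring)
      (le_refl (φ y)) (le_refl (φ y)) (hmin y)
    simpa [sub_mul] using h
end

section
/- Suppose K is spherically complete and let E = K^ℕ with the product topology. Then the subset A = K^(ℕ) of finitely supported sequences is ncf-compact but not cf-compact. -/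
open Pointwise Filter

/-- A convex function is controlled on the affine combination `x + c • (y - z)`. -/
theorem ConvexFun.le_max_add_smul_sub {K E : Type*} [NormedField K] [AddCommGroup E] [Module K E]
    {φ : E → ℝ} (hφ : ConvexFun K φ) (x y z : E) {c : K} (hc : ‖c‖ ≤ 1) :
    φ (x + c • (y - z)) ≤ max (φ x) (max (‖c‖ * φ y) (‖c‖ * φ z)) := by
  have h := hφ 2 ![x, y, z] ![1, c, -c]
    (by intro i; fin_cases i <;> simp [hc]) (by simp [Fin.sum_univ_three])
  have hsum : ∑ i, (![1, c, -c] : Fin 3 → K) i • (![x, y, z] : Fin 3 → E) i =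
      x + c • (y - z) := by
    simp [Fin.sum_univ_three, smul_sub]; abel
  rw [hsum] at h
  refine h.trans (Finset.sup'_le _ _ fun i _ => ?_)
  fin_cases i <;> simp

/-- A set is flat if it is stable under the combinations `x + c • (y - z)` with `‖c‖ ≤ 1`. -/
def KFlat (K : Type*) {E : Type*} [NormedField K] [AddCommGroup E] [Module K E]
    (C : Set E) : Prop :=
  ∀ x ∈ C, ∀ y ∈ C, ∀ z ∈ C, ∀ c : K, ‖c‖ ≤ 1 → x + c • (y - z) ∈ C

theorem ConvexFun.kFlat_sublevel {K E : Type*} [NormedField K] [AddCommGroup E] [Module K E]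
    {φ : E → ℝ} (hφ : ConvexFun K φ) (h0 : ∀ x, 0 ≤ φ x) (t : ℝ) :
    KFlat K {x | φ x ≤ t} := by
  intro x hx y hy z hz c hc
  refine (hφ.le_max_add_smul_sub x y z hc).trans (max_le hx (max_le ?_ ?_))
  · exact (mul_le_of_le_one_left (h0 y) hc).trans hy
  · exact (mul_le_of_le_one_left (h0 z) hc).trans hz

/-- A closed ball centred in a flat subset of `K` whose radius is attained lies in the subset. -/
theorem KFlat.closedBall_subset {K : Type*} [NormedField K] {C : Set K} (hC : KFlat K C)
    {c y : K} (hc : c ∈ C) (hy : y ∈ C) : Metric.closedBall c ‖y - c‖ ⊆ C := by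
  intro z hz
  rw [mem_closedBall_iff_norm] at hz
  rcases eq_or_ne y c with rfl | hne
  · have : z = y := by simpa [sub_eq_zero] using hz
    exact this ▸ hc
  · have hne' : y - c ≠ 0 := sub_ne_zero.2 hne
    have h := hC c hc y hy c hc ((z - c) / (y - c)) (by
      rw [norm_div]; exact div_le_one_of_le₀ hz (norm_nonneg _))
    rwa [smul_eq_mul, div_mul_cancel₀ _ hne', add_sub_cancel] at h

theorem SphericallyComplete.exists_forall_mem {K : Type*} [NormedField K] [IsUltrametricDist K]
    (hK : SphericallyComplete K) {C : ℕ → Set K} (hanti : Antitone C)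
    (hflat : ∀ n, KFlat K (C n)) (hne : ∀ n, (C n).Nonempty) : ∃ b, ∀ n, b ∈ C n := by
  by_cases hst : ∃ m, ∀ n, m ≤ n → C m ⊆ C n
  · obtain ⟨m, hm⟩ := hst
    obtain ⟨b, hb⟩ := hne m
    refine ⟨b, fun n => ?_⟩
    rcases le_total m n with h | h
    · exact hm n h hb
    · exact hanti h hb
  push Not at hst
  choose f hf hnot using hst
  choose y hyC hyn using fun m => Set.not_subset.1 (hnot m)
  choose c hc using hne
  let B : ℕ → Set K := fun m => Metric.closedBall (c (f m)) ‖y m - c (f m)‖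
  have hBC : ∀ m, B m ⊆ C m := fun m =>
    (hflat m).closedBall_subset (hanti (hf m) (hc _)) (hyC m)
  have hCB : ∀ m, C (f m) ⊆ B m := by
    intro m z hz
    by_contra hzB
    have hlt : ‖y m - c (f m)‖ < ‖z - c (f m)‖ := by
      simpa only [B, mem_closedBall_iff_norm, not_le] using hzB
    exact hyn m ((hflat (f m)).closedBall_subset (hc _) hz
      (mem_closedBall_iff_norm.2 hlt.le))
  obtain ⟨b, hb⟩ := hK (Set.range B) (Set.range_nonempty B)
    (by rintro _ ⟨m, rfl⟩; exact ⟨_, _, norm_nonneg _, rfl⟩)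
    (by
      rintro _ ⟨m, rfl⟩ _ ⟨n, rfl⟩ -
      have hm := hCB m (hanti (le_max_left (f m) (f n)) (hc _))
      have hn := hCB n (hanti (le_max_right (f m) (f n)) (hc _))
      rcases IsUltrametricDist.closedBall_subset_trichotomy
        (x := c (f m)) (y := c (f n)) (r := ‖y m - c (f m)‖) (s := ‖y n - c (f n)‖) with h | h | h
      · exact Or.inl h
      · exact Or.inr h
      · exact absurd hn (Set.disjoint_left.1 h hm))
  exact ⟨b, fun n => hBC n (hb _ ⟨n, rfl⟩)⟩

/-- A decreasing sequence of nonempty flat subsets of `K^ℕ` admits a common choice of any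
finite number of coordinates. -/
theorem SphericallyComplete.exists_forall_exists_eqOn {K : Type*} [NormedField K]
    [IsUltrametricDist K] (hK : SphericallyComplete K) {C : ℕ → Set (ℕ → K)}
    (hanti : Antitone C) (hflat : ∀ n, KFlat K (C n)) (hne : ∀ n, (C n).Nonempty) (N : ℕ) :
    ∃ a : ℕ → K, ∀ n, ∃ x ∈ C n, ∀ i < N, x i = a i := by
  induction N with
  | zero => exact ⟨0, fun n => (hne n).imp fun x hx => ⟨hx, by simp⟩⟩
  | succ N ih =>
    obtain ⟨a, ha⟩ := ih
    obtain ⟨b, hb⟩ := hK.exists_forall_mem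
      (C := fun n => {b | ∃ x ∈ C n, (∀ i < N, x i = a i) ∧ x N = b})
      (by
        rintro m n hmn _ ⟨x, hx, hxa, rfl⟩
        exact ⟨x, hanti hmn hx, hxa, rfl⟩)
      (by
        rintro n _ ⟨x, hx, hxa, rfl⟩ _ ⟨y, hy, hya, rfl⟩ _ ⟨z, hz, hza, rfl⟩ c hc
        refine ⟨_, hflat n x hx y hy z hz c hc, fun i hi => ?_, by simp⟩
        simp [hxa i hi, hya i hi, hza i hi])
      (fun n => let ⟨x, hx, hxa⟩ := ha n; ⟨x N, x, hx, hxa, rfl⟩)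
    refine ⟨Function.update a N b, fun n => ?_⟩
    obtain ⟨x, hx, hxa, hxb⟩ := hb n
    refine ⟨x, hx, fun i hi => ?_⟩
    rcases Nat.lt_succ_iff_lt_or_eq.1 hi with h | rfl
    · rw [Function.update_of_ne h.ne, hxa i h]
    · rw [Function.update_self, hxb]

/-- A non-negative continuous convex function on `K^ℕ` depends on finitely many coordinates. -/
theorem ConvexFun.exists_eq_of_eqOn {K : Type*} [NontriviallyNormedField K]
    {φ : (ℕ → K) → ℝ} (hφ : ConvexFun K φ) (hcont : Continuous φ) (h0 : ∀ x, 0 ≤ φ x) :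
    ∃ N : ℕ, ∀ x y : ℕ → K, (∀ i < N, x i = y i) → φ x = φ y := by
  have hnhds : {x | φ x < φ 0 + 1} ∈ nhds (0 : ℕ → K) :=
    (isOpen_lt hcont continuous_const).mem_nhds (by simp)
  rw [nhds_pi, Filter.mem_pi] at hnhds
  obtain ⟨I, hI, t, ht, hsub⟩ := hnhds
  obtain ⟨N, hN⟩ := hI.bddAbove
  have hL : ∀ z : ℕ → K, (∀ i < N + 1, z i = 0) → φ z < φ 0 + 1 := fun z hz =>
    hsub fun i hi => by
      rw [hz i (Nat.lt_succ_of_le (hN hi))]; exact mem_of_mem_nhds (ht i)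
  have key : ∀ x y : ℕ → K, (∀ i < N + 1, x i = y i) → φ y ≤ φ x := by
    intro x y hxy
    refine le_of_forall_pos_le_add fun ε hε => ?_
    set M := φ x + φ 0 + 1 with hM
    have hMpos : 0 < M := by linarith [h0 x, h0 0]
    obtain ⟨c, hc0, hc⟩ := NormedField.exists_norm_lt K (lt_min one_pos (div_pos hε hMpos))
    have hc1 : ‖c‖ ≤ 1 := (hc.trans_le (min_le_left _ _)).le
    have hcM : ‖c‖ * M ≤ ε :=
      ((lt_div_iff₀ hMpos).1 (hc.trans_le (min_le_right _ _))).le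
    have hbd : φ (x + c⁻¹ • (y - x)) ≤ M := by
      have h := hφ.le_max_add_smul_sub x (c⁻¹ • (y - x)) 0 (c := 1) (by simp)
      have hz := hL (c⁻¹ • (y - x)) fun i hi => by simp [hxy i hi]
      simp only [one_smul, sub_zero, norm_one, one_mul] at h
      refine h.trans (max_le ?_ (max_le ?_ ?_)) <;> linarith [h0 x, h0 0]
    have h := hφ.le_max_add_smul_sub x (x + c⁻¹ • (y - x)) x hc1
    rw [add_sub_cancel_left, smul_inv_smul₀ (norm_pos_iff.1 hc0), add_sub_cancel] at h
    refine h.trans (max_le (by linarith) (max_le ?_ ?_))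
    · linarith [mul_le_mul_of_nonneg_left hbd (norm_nonneg c), h0 x]
    · linarith [mul_le_of_le_one_left (h0 x) hc1]
  exact ⟨N + 1, fun x y hxy => le_antisymm (key y x fun i hi => (hxy i hi).symm) (key x y hxy)⟩

theorem SphericallyComplete.isNCFCompact_finite_support {K : Type*} [NontriviallyNormedField K]
    [IsUltrametricDist K] (hK : SphericallyComplete K) :
    IsNCFCompact K {x : ℕ → K | (Function.support x).Finite} := by
  intro φ hcont h0 hφ
  obtain ⟨N, hN⟩ := hφ.exists_eq_of_eqOn hcont h0
  have hbdd : BddBelow (Set.range φ) := ⟨0, by rintro _ ⟨x, rfl⟩; exact h0 x⟩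
  obtain ⟨a, ha⟩ := hK.exists_forall_exists_eqOn
    (C := fun n => {x | φ x ≤ (⨅ x, φ x) + 1 / ((n : ℝ) + 1)})
    (fun m n hmn x (hx : φ x ≤ _) => hx.trans
      (by simpa using Nat.one_div_le_one_div (α := ℝ) hmn))
    (fun n => hφ.kFlat_sublevel h0 _)
    (fun n => by
      obtain ⟨x, hx⟩ := exists_lt_of_ciInf_lt
        (lt_add_of_pos_right (⨅ x, φ x) (Nat.one_div_pos_of_nat (α := ℝ) (n := n)))
      exact ⟨x, hx.le⟩) N
  refine ⟨fun i => if i < N then a i else 0, (Set.finite_Iio N).subset fun i hi => ?_,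
    fun x _ => ?_⟩
  · by_contra h
    exact hi (if_neg h)
  · refine le_trans (le_of_forall_pos_le_add fun ε hε => ?_) (ciInf_le hbdd x)
    obtain ⟨n, hn⟩ := exists_nat_one_div_lt hε
    obtain ⟨y, hy, hya⟩ := ha n
    rw [hN _ y fun i hi => by simp [hi, hya i hi]]
    exact hy.trans (by linarith)

/-- A weighted distance to the constant sequence `1`, inducing the product topology. -/
noncomputable def weightedDistOne {K : Type*} [NormedField K] (x : ℕ → K) : ℝ :=
  ⨆ i : ℕ, (1 / 2 : ℝ) ^ i * min 1 ‖x i - 1‖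

section weightedDistOne

variable {K : Type*} [NormedField K]

theorem weightedDistOne_term_le (x : ℕ → K) (i : ℕ) :
    (1 / 2 : ℝ) ^ i * min 1 ‖x i - 1‖ ≤ (1 / 2) ^ i :=
  mul_le_of_le_one_right (by positivity) (min_le_left _ _)

theorem bddAbove_weightedDistOne (x : ℕ → K) :
    BddAbove (Set.range fun i : ℕ => (1 / 2 : ℝ) ^ i * min 1 ‖x i - 1‖) := by
  refine ⟨1, ?_⟩
  rintro _ ⟨i, rfl⟩
  exact (weightedDistOne_term_le x i).trans (pow_le_one₀ (by norm_num) (by norm_num))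

theorem le_weightedDistOne (x : ℕ → K) (i : ℕ) :
    (1 / 2 : ℝ) ^ i * min 1 ‖x i - 1‖ ≤ weightedDistOne x :=
  le_ciSup (bddAbove_weightedDistOne x) i

theorem weightedDistOne_nonneg (x : ℕ → K) : 0 ≤ weightedDistOne x :=
  le_trans (by positivity) (le_weightedDistOne x 0)

theorem weightedDistOne_le_one (x : ℕ → K) : weightedDistOne x ≤ 1 :=
  ciSup_le fun i =>
    (weightedDistOne_term_le x i).trans (pow_le_one₀ (by norm_num) (by norm_num))

theorem continuous_weightedDistOne : Continuous (weightedDistOne (K := K)) := by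
  have hterm : ∀ i : ℕ, Continuous fun x : ℕ → K => (1 / 2 : ℝ) ^ i * min 1 ‖x i - 1‖ :=
    fun i => by fun_prop
  refine continuous_iff_lower_upperSemicontinuous.2
    ⟨lowerSemicontinuous_ciSup bddAbove_weightedDistOne
      fun i => (hterm i).lowerSemicontinuous, fun x c hc => ?_⟩
  obtain ⟨d, hd, hdc⟩ := exists_between hc
  have hdpos : 0 < d := (weightedDistOne_nonneg x).trans_lt hd
  obtain ⟨N, hN⟩ := exists_pow_lt_of_lt_one hdpos (by norm_num : (1 / 2 : ℝ) < 1)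
  have hev : ∀ᶠ y in nhds x, ∀ i ∈ Set.Iio N, (1 / 2 : ℝ) ^ i * min 1 ‖y i - 1‖ < d :=
    (Filter.eventually_all_finite (Set.finite_Iio N)).2 fun i _ =>
      (hterm i).continuousAt.eventually_lt_const ((le_weightedDistOne x i).trans_lt hd)
  filter_upwards [hev] with y hy
  refine (ciSup_le fun i => ?_).trans_lt hdc
  rcases lt_or_ge i N with h | h
  · exact (hy i h).le
  · exact (weightedDistOne_term_le y i).trans
      ((pow_le_pow_of_le_one (by norm_num) (by norm_num) h).trans hN.le)

theorem convexFun_weightedDistOne_sub_one [IsUltrametricDist K] :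
    ConvexFun K fun x : ℕ → K => weightedDistOne x - 1 := by
  intro n x lam hlam hsum
  rw [sub_le_iff_le_add]
  refine ciSup_le fun i => ?_
  have hcoord : (∑ j, lam j • x j) i - 1 = ∑ j, lam j * (x j i - 1) := by
    simp [mul_sub, Finset.sum_sub_distrib, hsum]
  obtain ⟨j, -, hj⟩ := IsUltrametricDist.exists_norm_finsetSum_le_of_nonempty
    (Finset.univ_nonempty (α := Fin (n + 1))) fun j => lam j * (x j i - 1)
  have hle : ‖(∑ j, lam j • x j) i - 1‖ ≤ ‖x j i - 1‖ := by
    rw [hcoord]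
    refine hj.trans ?_
    rw [norm_mul]
    exact mul_le_of_le_one_left (norm_nonneg _) (hlam j)
  have hsup := Finset.le_sup' (fun j => ‖lam j‖ * (weightedDistOne (x j) - 1))
    (Finset.mem_univ j)
  have hterm : (1 / 2 : ℝ) ^ i * min 1 ‖(∑ j, lam j • x j) i - 1‖ ≤ weightedDistOne (x j) :=
    le_trans (by gcongr) (le_weightedDistOne (x j) i)
  have hneg : weightedDistOne (x j) - 1 ≤ ‖lam j‖ * (weightedDistOne (x j) - 1) := by
    nlinarith [hlam j, weightedDistOne_le_one (x j)]
  linarith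

theorem not_isCFCompact_finite_support [IsUltrametricDist K] :
    ¬ IsCFCompact K {x : ℕ → K | (Function.support x).Finite} := by
  intro h
  obtain ⟨a, ha, hmin⟩ := h _ (continuous_weightedDistOne.sub continuous_const)
    convexFun_weightedDistOne_sub_one
  obtain ⟨i, hi⟩ := ha.exists_notMem
  have hai : a i = 0 := Function.notMem_support.1 hi
  have hlow := le_weightedDistOne a i
  simp only [hai, zero_sub, norm_neg, norm_one, min_self, mul_one] at hlow
  have hle := hmin (fun j => if j ≤ i then 1 else 0)
    ((Set.finite_Iic i).subset fun j hj => by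
      by_contra hji
      exact hj (if_neg hji))
  have hup : weightedDistOne (fun j => if j ≤ i then (1 : K) else 0) ≤ (1 / 2) ^ (i + 1) := by
    refine ciSup_le fun j => ?_
    rcases le_or_gt j i with hj | hj
    · simp [hj]
    · exact (weightedDistOne_term_le (fun j => if j ≤ i then (1 : K) else 0) j).trans
        (pow_le_pow_of_le_one (by norm_num) (by norm_num) hj)
  have hpos : (0 : ℝ) < (1 / 2) ^ i := by positivity
  rw [pow_succ] at hup
  simp only [Pi.sub_apply] at hle
  linarith

end weightedDistOne

/-- for spherically complete `K`, the set of finitely supported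
sequences in `K^ℕ` (with the product topology) is ncf-compact but not cf-compact. -/
theorem statement11 {K : Type*} [NontriviallyNormedField K] [CompleteSpace K]
    [IsUltrametricDist K] (hK : SphericallyComplete K) :
    IsNCFCompact K {x : ℕ → K | (Function.support x).Finite} ∧
    ¬ IsCFCompact K {x : ℕ → K | (Function.support x).Finite} := by
  exact ⟨hK.isNCFCompact_finite_support, not_isCFCompact_finite_support⟩
end

section
/- Suppose K is spherically complete, let I be an uncountable index set, and let E = K^I with the product topology. Then the subset A = {(x_i)_{i∈I} ∈ E : the set {i ∈ I : x_i ≠ 0} is at most countable} is cf-compact but not c-compact. -/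
open Pointwise Filter

/-- A set closed under the affine combinations `x + c • (y - z)` with `‖c‖ ≤ 1`. -/
def IsAffineClosed (K : Type*) {E : Type*} [NormedField K] [AddCommGroup E] [Module K E]
    (D : Set E) : Prop :=
  ∀ x ∈ D, ∀ y ∈ D, ∀ z ∈ D, ∀ c : K, ‖c‖ ≤ 1 → x + c • (y - z) ∈ D

theorem IsAffineClosed.inter {K E : Type*} [NormedField K] [AddCommGroup E] [Module K E]
    {D D' : Set E} (h : IsAffineClosed K D) (h' : IsAffineClosed K D') :
    IsAffineClosed K (D ∩ D') := fun x hx y hy z hz c hc =>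
  ⟨h x hx.1 y hy.1 z hz.1 c hc, h' x hx.2 y hy.2 z hz.2 c hc⟩

theorem IsAffineClosed.image {K E F : Type*} [NormedField K] [AddCommGroup E] [Module K E]
    [AddCommGroup F] [Module K F] {D : Set E} (h : IsAffineClosed K D) (f : E →ₗ[K] F) :
    IsAffineClosed K (f '' D) := by
  rintro _ ⟨x, hx, rfl⟩ _ ⟨y, hy, rfl⟩ _ ⟨z, hz, rfl⟩ c hc
  exact ⟨x + c • (y - z), h x hx y hy z hz c hc, by simp⟩

theorem isAffineClosed_apply_eq {K I : Type*} [NormedField K] (i : I) (v : K) :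
    IsAffineClosed K {x : I → K | x i = v} := by
  intro x hx y hy z hz c _
  simp_all

/-- Affine combinations whose coefficients all have norm one do not increase a convex function
beyond its values, even where the function is negative. -/
theorem ConvexFun.le_of_norm_eq_one {K E : Type*} [NormedField K] [AddCommGroup E] [Module K E]
    {φ : E → ℝ} (hφ : ConvexFun K φ) {s : ℝ} {n : ℕ} (x : Fin (n + 1) → E)
    (lam : Fin (n + 1) → K) (hlam : ∀ i, ‖lam i‖ = 1) (hsum : ∑ i, lam i = 1)
    (hx : ∀ i, φ (x i) ≤ s) : φ (∑ i, lam i • x i) ≤ s := by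
  refine (hφ n x lam (fun i => (hlam i).le) hsum).trans (Finset.sup'_le _ _ fun i _ => ?_)
  simpa [hlam i] using hx i

theorem ConvexFun.isAffineClosed_sublevel {K E : Type*} [NormedField K] [IsUltrametricDist K]
    [AddCommGroup E] [Module K E] {φ : E → ℝ} (hφ : ConvexFun K φ) (s : ℝ) :
    IsAffineClosed K {x | φ x ≤ s} := by
  intro x hx y hy z hz c hc
  simp only [Set.mem_ofPred_eq] at hx hy hz ⊢
  rcases hc.eq_or_lt with h1 | h1
  · have h := hφ.le_of_norm_eq_one (s := s) ![x, y, z] ![1, c, -c]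
      (by intro i; fin_cases i <;> simp [h1]) (by simp [Fin.sum_univ_succ])
      (by intro i; fin_cases i <;> simp [hx, hy, hz])
    convert h using 2
    simp [Fin.sum_univ_succ]
    module
  · have hc1 : ‖1 + c‖ = 1 := by
      rw [IsUltrametricDist.norm_add_eq_max_of_norm_ne_norm (by simpa using h1.ne')]
      simpa using h1.le
    have hc2 : ‖-1 + -c‖ = 1 := by rw [← neg_add, norm_neg, hc1]
    have h := hφ.le_of_norm_eq_one (s := s) ![x, y, y, z, z] ![1, 1 + c, -1, -1 + -c, 1]
      (by intro i; fin_cases i <;> simp [hc1, hc2])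
      (by simp [Fin.sum_univ_succ]; ring)
      (by intro i; fin_cases i <;> simp [hx, hy, hz])
    convert h using 2
    simp [Fin.sum_univ_succ]
    module

theorem IsAffineClosed.closedBall_subset {K : Type*} [NormedField K] {T : Set K}
    (hT : IsAffineClosed K T) {a b : K} (ha : a ∈ T) (hb : b ∈ T) :
    Metric.closedBall a ‖b - a‖ ⊆ T := by
  intro t ht
  rw [mem_closedBall_iff_norm] at ht
  rcases eq_or_ne b a with rfl | hba
  · have : t = b := by simpa [sub_eq_zero] using ht
    rwa [this]
  · have hne : b - a ≠ 0 := sub_ne_zero.2 hba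
    have h := hT a ha b hb a ha ((t - a) / (b - a))
      (by rw [norm_div]; exact div_le_one_of_le₀ ht (norm_nonneg _))
    rw [smul_eq_mul, div_mul_cancel₀ _ hne] at h
    simpa using h

theorem SphericallyComplete.iInter_nonempty {K : Type*} [NormedField K] [IsUltrametricDist K]
    (hK : SphericallyComplete K) {T : ℕ → Set K} (hanti : Antitone T)
    (hne : ∀ n, (T n).Nonempty) (hT : ∀ n, IsAffineClosed K (T n)) : (⋂ n, T n).Nonempty := by
  choose t ht using hne
  by_cases hex : ∃ N, ∀ m, t N ∈ T m
  · obtain ⟨N, hN⟩ := hex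
    exact ⟨t N, Set.mem_iInter.2 hN⟩
  push Not at hex
  choose m hm using hex
  have hlt : ∀ N, N < m N := fun N => by
    by_contra! h
    exact hm N (hanti h (ht N))
  have hmem : ∀ N k, m N ≤ k → t k ∈ Metric.closedBall (t N) ‖t (m N) - t N‖ := by
    intro N k hk
    have h1 : ‖t k - t (m N)‖ ≤ ‖t (m N) - t N‖ := by
      by_contra! h
      refine hm N ((hT (m N)).closedBall_subset (ht (m N)) (hanti hk (ht k)) ?_)
      rw [mem_closedBall_iff_norm, norm_sub_rev]
      exact h.le
    rw [mem_closedBall_iff_norm, ← sub_add_sub_cancel (t k) (t (m N)) (t N)]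
    exact (IsUltrametricDist.norm_add_le_max _ _).trans (max_le h1 le_rfl)
  obtain ⟨z, hz⟩ := hK (Set.range fun N => Metric.closedBall (t N) ‖t (m N) - t N‖)
    (Set.range_nonempty _)
    (by rintro _ ⟨N, rfl⟩; exact ⟨_, _, norm_nonneg _, rfl⟩)
    (by
      rintro _ ⟨N, rfl⟩ _ ⟨N', rfl⟩ _
      rcases IsUltrametricDist.closedBall_subset_trichotomy (x := t N) (y := t N')
        (r := ‖t (m N) - t N‖) (s := ‖t (m N') - t N'‖) with h | h | h
      · exact Or.inl h
      · exact Or.inr h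
      · exact absurd h (Set.not_disjoint_iff.2 ⟨t (max (m N) (m N')),
          hmem N _ (le_max_left _ _), hmem N' _ (le_max_right _ _)⟩))
  refine ⟨z, Set.mem_iInter.2 fun N => ?_⟩
  exact (hT N).closedBall_subset (ht N) (hanti (hlt N).le (ht (m N))) (hz _ ⟨N, rfl⟩)

theorem SphericallyComplete.exists_apply_eq {K I : Type*} [NormedField K] [IsUltrametricDist K]
    (hK : SphericallyComplete K) {D : ℕ → Set (I → K)} (hanti : Antitone D)
    (hne : ∀ n, (D n).Nonempty) (hD : ∀ n, IsAffineClosed K (D n)) (i : I) :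
    ∃ v : K, ∀ n, (D n ∩ {x | x i = v}).Nonempty := by
  obtain ⟨v, hv⟩ := hK.iInter_nonempty
    (T := fun n => (LinearMap.proj i : (I → K) →ₗ[K] K) '' D n)
    (fun _ _ h => Set.image_mono (hanti h)) (fun n => (hne n).image _)
    (fun n => (hD n).image _)
  refine ⟨v, fun n => ?_⟩
  obtain ⟨x, hx, hxv⟩ := Set.mem_iInter.1 hv n
  exact ⟨x, hx, hxv⟩

/-- From a decreasing sequence of nonempty affine-closed sets one can pick a sequence of points
which is eventually constant along each of countably many coordinates. -/
theorem SphericallyComplete.exists_seq_eventually_apply_eq {K I : Type*} [NormedField K]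
    [IsUltrametricDist K] (hK : SphericallyComplete K) {D : ℕ → Set (I → K)}
    (hanti : Antitone D) (hne : ∀ n, (D n).Nonempty) (hD : ∀ n, IsAffineClosed K (D n))
    (e : ℕ → I) :
    ∃ (x : ℕ → I → K) (v : ℕ → K), (∀ n, x n ∈ D n) ∧
      ∀ k, ∀ᶠ n in atTop, x n (e k) = v k := by
  let P : (ℕ → Set (I → K)) → Prop := fun D =>
    Antitone D ∧ (∀ n, (D n).Nonempty) ∧ ∀ n, IsAffineClosed K (D n)
  have step : ∀ (S : {D // P D}) (i : I), ∃ v : K, ∀ n, (S.1 n ∩ {x | x i = v}).Nonempty :=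
    fun S i => hK.exists_apply_eq S.2.1 S.2.2.1 S.2.2.2 i
  choose v hv using step
  let next : ℕ → {D // P D} → {D // P D} := fun k S =>
    ⟨fun n => S.1 n ∩ {x | x (e k) = v S (e k)},
      fun _ _ h => Set.inter_subset_inter_left _ (S.2.1 h), hv S (e k),
      fun n => (S.2.2.2 n).inter (isAffineClosed_apply_eq _ _)⟩
  let S : ℕ → {D // P D} := fun k => Nat.rec ⟨D, hanti, hne, hD⟩ next k
  have hsucc : ∀ k n, (S (k + 1)).1 n = (S k).1 n ∩ {x | x (e k) = v (S k) (e k)} :=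
    fun _ _ => rfl
  have hS : ∀ n, Antitone fun k => (S k).1 n := fun n =>
    antitone_nat_of_succ_le fun k => by
      rw [hsucc]
      exact Set.inter_subset_left
  choose x hx using fun n => (S n).2.2.1 n
  refine ⟨x, fun k => v (S k) (e k), fun n => hS n (Nat.zero_le n) (hx n), fun k => ?_⟩
  filter_upwards [eventually_ge_atTop (k + 1)] with n hn
  have h := hS n hn (hx n)
  simp only [hsucc] at h
  exact h.2

theorem isCFCompact_countable_support {K : Type*} [NormedField K] [IsUltrametricDist K]
    (hK : SphericallyComplete K) {I : Type*} [Nonempty I] :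
    IsCFCompact K {x : I → K | (Function.support x).Countable} := by
  intro φ hcont hφ
  set A := {x : I → K | (Function.support x).Countable}
  have hA : A.Nonempty := ⟨0, by simp [A]⟩
  obtain ⟨u, hu, hlim, hmem⟩ := exists_seq_tendsto_sInf
    (hA.image fun x => (φ x : EReal)) (OrderBot.bddBelow _)
  choose a ha hau using hmem
  have hanti : Antitone fun n => φ (a n) := fun n n' h => by
    have := hu h
    rw [← hau n, ← hau n'] at this
    exact EReal.coe_le_coe_iff.1 this
  obtain ⟨e, he⟩ := Set.countable_iff_exists_subset_range.1
    (Set.countable_iUnion fun n => (ha n : (Function.support (a n)).Countable))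
  have hzero : IsAffineClosed K {x : I → K | ∀ i ∉ Set.range e, x i = 0} := by
    intro x hx y hy z hz c _ i hi
    simp [hx i hi, hy i hi, hz i hi]
  obtain ⟨x, v, hx, hv⟩ := hK.exists_seq_eventually_apply_eq
    (D := fun n => {x | φ x ≤ φ (a n)} ∩ {x | ∀ i ∉ Set.range e, x i = 0})
    (fun n n' h => Set.inter_subset_inter_left _ fun y hy => le_trans hy (hanti h))
    (fun n => ⟨a n, le_refl (φ (a n)), fun i hi => by
      by_contra h
      exact hi (he (Set.mem_iUnion.2 ⟨n, h⟩))⟩)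
    (fun n => (hφ.isAffineClosed_sublevel _).inter hzero) e
  have hy : ∀ i, ∃ w : K, (i ∉ Set.range e → w = 0) ∧ ∀ᶠ n in atTop, x n i = w := by
    intro i
    by_cases hi : i ∈ Set.range e
    · obtain ⟨k, rfl⟩ := hi
      exact ⟨v k, fun h => absurd ⟨k, rfl⟩ h, hv k⟩
    · exact ⟨0, fun _ => rfl, Eventually.of_forall fun n => (hx n).2 i hi⟩
  choose y hy0 hyv using hy
  have hxy : Tendsto x atTop (nhds y) := tendsto_pi_nhds.2 fun i =>
    tendsto_const_nhds.congr' ((hyv i).mono fun n h => h.symm)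
  have hle : ∀ n, φ y ≤ φ (a n) := fun n =>
    le_of_tendsto ((hcont.tendsto y).comp hxy)
      ((eventually_ge_atTop n).mono fun k hk => (hx k).1.trans (hanti hk))
  refine ⟨y, (Set.countable_range e).mono fun i hi => ?_, fun z hz => ?_⟩
  · by_contra h
    exact hi (hy0 i h)
  · have h1 : (φ y : EReal) ≤ sInf ((fun x => (φ x : EReal)) '' A) :=
      ge_of_tendsto' hlim fun n => by
        rw [← hau n]
        exact EReal.coe_le_coe_iff.2 (hle n)
    exact EReal.coe_le_coe_iff.1 (h1.trans (sInf_le ⟨z, hz, rfl⟩))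

theorem not_isCCompact_countable_support {K : Type*} [NormedField K] {I : Type*}
    [Uncountable I] : ¬ IsCCompact K {x : I → K | (Function.support x).Countable} := by
  classical
  intro h
  set A := {x : I → K | (Function.support x).Countable}
  have hadd : ∀ x ∈ A, ∀ y ∈ A, x + y ∈ A := fun x hx y hy =>
    (Set.Countable.union hx hy).mono (Function.support_add x y)
  have hsmul : ∀ (c : K), ∀ x ∈ A, c • x ∈ A := fun c x hx =>
    Set.Countable.mono (Function.support_const_smul_subset c x) hx
  have hsingle : ∀ i (c : K), Pi.single i c ∈ A := fun i c =>
    (Set.countable_singleton i).mono Pi.support_single_subset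
  obtain ⟨x, hx⟩ := h (Set.range fun i => A ∩ {x | x i = 1}) (by
      rintro _ ⟨i, rfl⟩
      refine ⟨Set.inter_subset_left, ?_, Pi.single i 1, A ∩ {x | x i = 0},
        ⟨⟨by simp [A], rfl⟩, ?_, ?_⟩, ?_⟩
      · have : IsClosed {x : A | x.1 i = 1} :=
          isClosed_eq ((continuous_apply i).comp continuous_subtype_val) continuous_const
        convert this using 1
        ext x
        simp
      · rintro x ⟨hx, hx0⟩ y ⟨hy, hy0⟩
        exact ⟨hadd x hx y hy, by simp_all⟩
      · rintro c _ x ⟨hx, hx0⟩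
        exact ⟨hsmul c x hx, by simp_all⟩
      · ext x
        constructor
        · rintro ⟨hx, hx1⟩
          refine ⟨x - Pi.single i 1, ⟨?_, ?_⟩, by simp⟩
          · rw [sub_eq_add_neg, ← Pi.single_neg]
            exact hadd x hx _ (hsingle i _)
          · simp_all
        · rintro ⟨y, ⟨hy, hy0⟩, rfl⟩
          exact ⟨hadd _ (hsingle i 1) y hy, by simp_all⟩) (by
      intro 𝒟 h𝒟
      obtain ⟨F, -, rfl⟩ := Finset.subset_set_image_iff.1 (by rwa [← Set.image_univ] at h𝒟)
      refine ⟨fun i => if i ∈ F then 1 else 0, ?_⟩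
      simp only [Finset.coe_image, Set.sInter_image, Set.mem_iInter]
      intro i hi
      refine ⟨(F.countable_toSet).mono fun j hj => ?_, by simpa using hi⟩
      by_contra hjF
      simp_all)
  have hx1 : ∀ i, x ∈ A ∩ {x | x i = 1} := fun i => hx _ ⟨i, rfl⟩
  obtain ⟨i⟩ : Nonempty I := inferInstance
  have hsupp : Function.support x = Set.univ := by
    ext j
    simp [(hx1 j).2.out]
  have hcount : (Function.support x).Countable := (hx1 i).1
  rw [hsupp] at hcount
  exact Set.not_countable_univ hcount

/-- for spherically complete `K` and uncountable `I`, the set of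
countably supported elements of `K^I` (with the product topology) is cf-compact
but not c-compact. -/
theorem statement12 {K : Type*} [NontriviallyNormedField K] [CompleteSpace K]
    [IsUltrametricDist K] (hK : SphericallyComplete K) {I : Type*} [Uncountable I] :
    IsCFCompact K {x : I → K | (Function.support x).Countable} ∧
    ¬ IsCCompact K {x : I → K | (Function.support x).Countable} := by
  exact ⟨isCFCompact_countable_support hK, not_isCCompact_countable_support⟩
end

section
/- Let (E, ‖·‖) be a non-archimedean normed space over K and let A be a local compactoid in E. Then there exist a finite-dimensional K-subspace F ⊆ E and a compactoid B ⊆ E such that A ⊆ F + B. -/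
open Pointwise Filter

/-- Over a complete field, bounded parts of a finite-dimensional subspace lie in the absolutely
convex hull of a finite set. -/
theorem exists_closedBall_inter_subset_acoHull {K : Type*} [NontriviallyNormedField K]
    [CompleteSpace K] {E : Type*} [NormedAddCommGroup E] [NormedSpace K E]
    (D : Submodule K E) [FiniteDimensional K D] (r : ℝ) :
    ∃ G : Finset E, Metric.closedBall (0 : E) r ∩ D ⊆ acoHull K (G : Set E) := by
  classical
  let b := Module.finBasis K D
  let e : D →L[K] (Fin (Module.finrank K D) → K) := b.equivFunL
  obtain ⟨c, hc⟩ := NormedField.exists_lt_norm K (max 0 (‖e‖ * r))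
  have hc0 : 0 < ‖c‖ := (le_max_left _ _).trans_lt hc
  have hc0' : c ≠ 0 := norm_pos_iff.1 hc0
  refine ⟨Finset.univ.image fun i => c • (b i : E), ?_⟩
  rintro x ⟨hxr, hxD⟩
  refine ⟨_, fun i => c⁻¹ * e ⟨x, hxD⟩ i, fun i => c • (b i : E), fun i => ?_, fun i => ?_, ?_⟩
  · have hx : ‖x‖ ≤ r := by simpa using hxr
    have h : ‖e ⟨x, hxD⟩ i‖ ≤ ‖c‖ := calc
      ‖e ⟨x, hxD⟩ i‖ ≤ ‖e ⟨x, hxD⟩‖ := norm_le_pi_norm _ i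
      _ ≤ ‖e‖ * ‖x‖ := e.le_opNorm _
      _ ≤ ‖e‖ * r := by gcongr
      _ ≤ ‖c‖ := (le_max_right _ _).trans hc.le
    rw [norm_mul, norm_inv]
    exact inv_mul_le_one_of_le₀ h hc0.le
  · simp
  · have h := congrArg (Subtype.val : D → E) (b.sum_equivFun ⟨x, hxD⟩)
    rw [Submodule.coe_sum] at h
    refine h.symm.trans (Finset.sum_congr rfl fun i _ => ?_)
    rw [smul_smul, mul_right_comm, inv_mul_cancel₀ hc0', one_mul]
    rfl

/-- A bounded local compactoid is a compactoid. -/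
theorem IsLocalCompactoid.isCompactoid_of_subset_closedBall {K : Type*}
    [NontriviallyNormedField K] [CompleteSpace K] {E : Type*} [NormedAddCommGroup E]
    [NormedSpace K E] {A : Set E} (hA : IsLocalCompactoid K A) {r : ℝ}
    (hr : A ⊆ Metric.closedBall 0 r) : IsCompactoid K A := by
  intro U hU
  obtain ⟨ε, hε, hεU⟩ := Metric.mem_nhds_iff.1 hU
  obtain ⟨S, hS⟩ := hA _ (Metric.ball_mem_nhds 0 hε)
  obtain ⟨G, hG⟩ := exists_closedBall_inter_subset_acoHull (Submodule.span K (S : Set E)) (r + ε)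
  refine ⟨G, fun x hx => ?_⟩
  obtain ⟨u, hu, d, hd, rfl⟩ := hS hx
  refine Set.add_mem_add (hεU hu) (hG ⟨?_, hd⟩)
  have hx' : ‖u + d‖ ≤ r := by simpa using hr hx
  have hu' : ‖u‖ < ε := by simpa using hu
  have h : ‖d‖ ≤ ‖u + d‖ + ‖u‖ := by simpa using norm_sub_le (u + d) u
  rw [mem_closedBall_zero_iff]
  linarith

/-- A local compactoid plus the span of a finite set is a local compactoid. -/
theorem IsLocalCompactoid.add_span {K : Type*} [NormedField K] {E : Type*} [AddCommGroup E]
    [Module K E] [TopologicalSpace E] {A : Set E} (hA : IsLocalCompactoid K A) (T : Finset E) :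
    IsLocalCompactoid K (A + (Submodule.span K (T : Set E) : Set E)) := by
  classical
  intro U hU
  obtain ⟨S, hS⟩ := hA U hU
  refine ⟨S ∪ T, ?_⟩
  rintro _ ⟨a, ha, t, ht, rfl⟩
  obtain ⟨u, hu, s, hs, rfl⟩ := hS ha
  refine ⟨u, hu, s + t, ?_, (add_assoc u s t).symm⟩
  rw [Finset.coe_union, Submodule.span_union]
  exact Submodule.add_mem_sup hs ht

theorem AbsolutelyConvex.add {K : Type*} {E : Type*} [NormedField K] [AddCommGroup E]
    [Module K E] {A B : Set E} (hA : AbsolutelyConvex K A) (hB : AbsolutelyConvex K B) :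
    AbsolutelyConvex K (A + B) := by
  refine ⟨⟨0, hA.1, 0, hB.1, add_zero 0⟩, ?_, ?_⟩
  · rintro _ ⟨a, ha, b, hb, rfl⟩ _ ⟨a', ha', b', hb', rfl⟩
    exact ⟨a + a', hA.2.1 a ha a' ha', b + b', hB.2.1 b hb b' hb', add_add_add_comm a a' b b'⟩
  · rintro c hc _ ⟨a, ha, b, hb, rfl⟩
    exact ⟨c • a, hA.2.2 c hc a ha, c • b, hB.2.2 c hc b hb, (smul_add c a b).symm⟩

theorem AbsolutelyConvex.inter {K : Type*} {E : Type*} [NormedField K] [AddCommGroup E]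
    [Module K E] {A B : Set E} (hA : AbsolutelyConvex K A) (hB : AbsolutelyConvex K B) :
    AbsolutelyConvex K (A ∩ B) :=
  ⟨⟨hA.1, hB.1⟩, fun x hx y hy => ⟨hA.2.1 x hx.1 y hy.1, hB.2.1 x hx.2 y hy.2⟩,
    fun c hc x hx => ⟨hA.2.2 c hc x hx.1, hB.2.2 c hc x hx.2⟩⟩

theorem Submodule.absolutelyConvex {K : Type*} {E : Type*} [NormedField K] [AddCommGroup E]
    [Module K E] (D : Submodule K E) : AbsolutelyConvex K (D : Set E) :=
  ⟨D.zero_mem, fun _ hx _ hy => D.add_mem hx hy, fun c _ _ hx => D.smul_mem c hx⟩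

theorem absolutelyConvex_closedBall {K : Type*} [NormedField K] {E : Type*}
    [NormedAddCommGroup E] [NormedSpace K E] [IsUltrametricDist E] {r : ℝ} (hr : 0 ≤ r) :
    AbsolutelyConvex K (Metric.closedBall (0 : E) r) := by
  simp only [AbsolutelyConvex, mem_closedBall_zero_iff]
  refine ⟨by simpa using hr, fun x hx y hy => ?_, fun c hc x hx => ?_⟩
  · exact (IsUltrametricDist.norm_add_le_max x y).trans (max_le hx hy)
  · rw [norm_smul]
    exact (mul_le_of_le_one_left (norm_nonneg x) hc).trans hx

/-- a local compactoid in a non-archimedean normed space is contained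
in the sum of a finite-dimensional subspace and a compactoid. -/
theorem statement13 {K : Type*} [NontriviallyNormedField K] [CompleteSpace K]
    [IsUltrametricDist K] {E : Type*} [NormedAddCommGroup E] [NormedSpace K E]
    [IsUltrametricDist E]
    (A : Set E) (hA : AbsolutelyConvex K A) (hloc : IsLocalCompactoid K A) :
    ∃ (F : Submodule K E) (B : Set E), FiniteDimensional K F ∧
      AbsolutelyConvex K B ∧ IsCompactoid K B ∧ A ⊆ (F : Set E) + B := by
  obtain ⟨S, hS⟩ := hloc _ (Metric.closedBall_mem_nhds 0 one_pos)
  set D := Submodule.span K (S : Set E)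
  have hB : IsLocalCompactoid K ((A + (D : Set E)) ∩ Metric.closedBall (0 : E) 1) := fun U hU =>
    (hloc.add_span S U hU).imp fun _ h => Set.inter_subset_left.trans h
  refine ⟨D, _, FiniteDimensional.span_finset K S,
    (hA.add D.absolutelyConvex).inter (absolutelyConvex_closedBall zero_le_one),
    hB.isCompactoid_of_subset_closedBall Set.inter_subset_right, fun a ha => ?_⟩
  obtain ⟨u, hu, d, hd, rfl⟩ := hS ha
  exact ⟨d, hd, u, ⟨⟨u + d, ha, -d, D.neg_mem hd, add_neg_cancel_right u d⟩, hu⟩, add_comm d u⟩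
end

section
/- Let (E, ‖·‖) be a non-archimedean normed space over K and let A be a local compactoid in E. If the K-linear span [A] of A is infinite dimensional, then [A] (with the induced norm) is not a Banach space (i.e., not complete). -/
open Pointwise Filter

/-- If every vector of an infinite-dimensional subspace `F` is within relative distance `t < 1`
of `D`, then arbitrarily long linearly independent families in `F` can be approximated by
families in `D`, with relative error at most `c` on all linear combinations, for any `c > t`. -/
lemma exists_linearIndependent_approx {K : Type*} [NontriviallyNormedField K] [CompleteSpace K]
    {E : Type*} [NormedAddCommGroup E] [NormedSpace K E] [IsUltrametricDist E]
    {F D : Submodule K E} (hF : ¬ FiniteDimensional K F) {t : ℝ} (ht : 0 < t)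
    (hFD : ∀ x ∈ F, ∃ d ∈ D, ‖x - d‖ ≤ t * ‖x‖) (n : ℕ) :
    ∀ c : ℝ, t < c → c < 1 → ∃ (v : Fin n → F) (d : Fin n → D), LinearIndependent K v ∧
      ∀ a : Fin n → K,
        ‖∑ i, a i • ((v i : E) - d i)‖ ≤ c * ‖∑ i, a i • (v i : E)‖ := by
  induction n with
  | zero => exact fun c _ _ => ⟨fun _ => 0, fun _ => 0, linearIndependent_empty_type, by simp⟩
  | succ n ih =>
    intro c htc hc1
    have hc0 : 0 < c := ht.trans htc
    obtain ⟨s, hs, hs1⟩ := exists_between ((div_lt_one hc0).2 htc)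
    have hs0 : 0 < s := (div_pos ht hc0).trans hs
    have hcs : t < c * s := by
      rw [div_lt_iff₀ hc0] at hs
      linarith
    obtain ⟨v, d, hv, hvd⟩ := ih (c * s) hcs (by nlinarith)
    set W : Submodule K F := Submodule.span K (Set.range v) with hW
    have : FiniteDimensional K W := FiniteDimensional.span_of_finite K (Set.finite_range v)
    have hWtop : ∃ x : F, x ∉ W := by
      by_contra! h
      apply hF
      have hWF : W = ⊤ := eq_top_iff.2 fun x _ => h x
      rw [hWF] at this
      exact Submodule.topEquiv.finiteDimensional
    obtain ⟨x, hxW, hx⟩ := riesz_lemma W.closed_of_finiteDimensional hWtop hs1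
    obtain ⟨e, he, hxe⟩ := hFD x x.2
    refine ⟨Fin.cons x v, Fin.cons ⟨e, he⟩ d, linearIndependent_finCons.2 ⟨hv, hxW⟩,
      fun a => ?_⟩
    simp only [Fin.sum_univ_succ, Fin.cons_zero, Fin.cons_succ]
    set w : E := ∑ i : Fin n, a i.succ • (v i : E) with hw
    set N := ‖a 0 • (x : E) + w‖ with hN
    have hN0 : 0 ≤ N := norm_nonneg _
    have hxN : s * ‖a 0 • (x : E)‖ ≤ N := by
      by_cases ha : a 0 = 0
      · simpa [ha] using hN0
      have hmem : -((a 0)⁻¹ • ∑ i : Fin n, a i.succ • v i) ∈ W :=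
        W.neg_mem (W.smul_mem _ (W.sum_mem fun i _ =>
          W.smul_mem _ (Submodule.subset_span ⟨i, rfl⟩)))
      have h := hx _ hmem
      have hEq : a 0 • (x : E) + w =
          a 0 • ((x - -((a 0)⁻¹ • ∑ i : Fin n, a i.succ • v i) : F) : E) := by
        simp [hw, smul_smul, ha]
      rw [hN, hEq, norm_smul, norm_smul]
      have h' := mul_le_mul_of_nonneg_left h (norm_nonneg (a 0))
      rw [Submodule.coe_norm, Submodule.coe_norm] at h'
      linarith
    have hwN : s * ‖w‖ ≤ N := by
      have h : ‖w‖ ≤ max N ‖a 0 • (x : E)‖ := by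
        calc ‖w‖ = ‖(a 0 • (x : E) + w) + -(a 0 • (x : E))‖ := by congr 1; abel
          _ ≤ _ := by simpa only [norm_neg] using IsUltrametricDist.norm_add_le_max
                        (a 0 • (x : E) + w) (-(a 0 • (x : E)))
      rcases le_max_iff.1 h with h | h <;> nlinarith [norm_nonneg w]
    refine (IsUltrametricDist.norm_add_le_max _ _).trans (max_le ?_ ?_)
    · calc ‖a 0 • ((x : E) - e)‖ ≤ ‖a 0‖ * (t * ‖(x : E)‖) := by
            rw [norm_smul]; gcongr
        _ = t * ‖a 0 • (x : E)‖ := by rw [norm_smul]; ring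
        _ ≤ c * s * ‖a 0 • (x : E)‖ := by gcongr
        _ = c * (s * ‖a 0 • (x : E)‖) := by ring
        _ ≤ c * N := by gcongr
    · calc _ ≤ c * s * ‖w‖ := hvd fun i => a i.succ
        _ = c * (s * ‖w‖) := by ring
        _ ≤ c * N := by gcongr

/-- A subspace all of whose vectors are within relative distance `t < 1` of a finite-dimensional
subspace is finite-dimensional. -/
lemma finiteDimensional_of_approx {K : Type*} [NontriviallyNormedField K] [CompleteSpace K]
    {E : Type*} [NormedAddCommGroup E] [NormedSpace K E] [IsUltrametricDist E]
    {F D : Submodule K E} [FiniteDimensional K D] {t : ℝ} (ht : 0 < t) (ht1 : t < 1)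
    (hFD : ∀ x ∈ F, ∃ d ∈ D, ‖x - d‖ ≤ t * ‖x‖) : FiniteDimensional K F := by
  by_contra hF
  obtain ⟨c, htc, hc1⟩ := exists_between ht1
  obtain ⟨v, d, hv, hvd⟩ :=
    exists_linearIndependent_approx hF ht hFD (Module.finrank K D + 1) c htc hc1
  have hd : LinearIndependent K d := by
    rw [Fintype.linearIndependent_iff] at hv ⊢
    intro a ha
    refine hv a ?_
    have ha' : ∑ i, a i • (d i : E) = 0 := by simpa using congrArg (Subtype.val) ha
    have h := hvd a
    simp only [smul_sub, Finset.sum_sub_distrib, ha', sub_zero] at h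
    have h0 : ‖∑ i, a i • (v i : E)‖ = 0 := by
      nlinarith [norm_nonneg (∑ i, a i • (v i : E))]
    rw [norm_eq_zero] at h0
    ext
    simpa using h0
  simpa using hd.fintype_card_le_finrank

/-- An absolutely convex set as an additive subgroup. -/
def AbsolutelyConvex.toAddSubgroup {K : Type*} {E : Type*} [NormedField K] [AddCommGroup E]
    [Module K E] {A : Set E} (hA : AbsolutelyConvex K A) : AddSubgroup E where
  carrier := A
  zero_mem' := hA.1
  add_mem' {x y} hx hy := hA.2.1 x hx y hy
  neg_mem' {x} hx := by simpa using hA.2.2 (-1) (by simp) x hx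

/-- The span of an absolutely convex set is the union of its dilations by the powers of a scalar
of norm greater than one. -/
lemma AbsolutelyConvex.exists_pow_inv_smul_mem {K : Type*} {E : Type*} [NormedField K]
    [AddCommGroup E] [Module K E] {A : Set E} (hA : AbsolutelyConvex K A) {c : K} (hc : 1 < ‖c‖)
    {x : E} (hx : x ∈ Submodule.span K A) : ∃ n : ℕ, (c ^ n)⁻¹ • x ∈ A := by
  have hc0 : c ≠ 0 := norm_pos_iff.1 (one_pos.trans hc)
  have mono : ∀ {m n : ℕ} {y : E}, m ≤ n → (c ^ m)⁻¹ • y ∈ A → (c ^ n)⁻¹ • y ∈ A := by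
    intro m n y hmn hy
    obtain ⟨k, rfl⟩ := Nat.exists_eq_add_of_le hmn
    have h := hA.2.2 (c ^ k)⁻¹ (by
      rw [norm_inv, norm_pow]
      exact inv_le_one_of_one_le₀ (one_le_pow₀ hc.le)) _ hy
    rwa [smul_smul, ← mul_inv, ← pow_add, add_comm k m] at h
  induction hx using Submodule.span_induction with
  | mem x hx => exact ⟨0, by simpa using hx⟩
  | zero => exact ⟨0, by simpa using hA.1⟩
  | add x y _ _ hx hy =>
    obtain ⟨m, hm⟩ := hx
    obtain ⟨n, hn⟩ := hy
    refine ⟨max m n, ?_⟩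
    rw [smul_add]
    exact hA.2.1 _ (mono (le_max_left _ _) hm) _ (mono (le_max_right _ _) hn)
  | smul a x _ hx =>
    obtain ⟨m, hm⟩ := hx
    obtain ⟨k, hk⟩ := pow_unbounded_of_one_lt ‖a‖ hc
    refine ⟨k + m, ?_⟩
    have h := hA.2.2 ((c ^ k)⁻¹ * a) (by
      rw [norm_mul, norm_inv, norm_pow, inv_mul_le_one₀ (by positivity)]
      exact hk.le) _ hm
    rwa [smul_smul, mul_right_comm, ← mul_inv, ← pow_add, ← smul_smul] at h

/-- By the Baire category theorem, some dilation of an absolutely convex set with complete span is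
dense in a ball of the span. -/
lemma AbsolutelyConvex.exists_ball_subset_closure {K : Type*} [NormedField K]
    {E : Type*} [NormedAddCommGroup E] [NormedSpace K E] {A : Set E} (hA : AbsolutelyConvex K A)
    {c : K} (hc : 1 < ‖c‖) (hcomp : IsComplete (Submodule.span K A : Set E)) :
    ∃ n : ℕ, ∃ ρ > 0, ∀ z ∈ Submodule.span K A, ‖z‖ < ρ →
      ∀ ε > 0, ∃ x : E, (c ^ n)⁻¹ • x ∈ A ∧ ‖z - x‖ < ε := by
  have : CompleteSpace (Submodule.span K A) := hcomp.completeSpace_coe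
  let X : ℕ → AddSubgroup (Submodule.span K A) := fun n =>
    hA.toAddSubgroup.comap
      ((DistribSMul.toAddMonoidHom E (c ^ n)⁻¹).comp (Submodule.span K A).subtype.toAddMonoidHom)
  have hX : ∀ n (x : Submodule.span K A), x ∈ X n ↔ (c ^ n)⁻¹ • (x : E) ∈ A :=
    fun _ _ => Iff.rfl
  have hU : ⋃ n, ((X n).topologicalClosure : Set (Submodule.span K A)) = Set.univ := by
    refine Set.eq_univ_of_forall fun x => ?_
    obtain ⟨n, hn⟩ := hA.exists_pow_inv_smul_mem hc x.2
    exact Set.mem_iUnion.2 ⟨n, (X n).le_topologicalClosure ((hX n x).2 hn)⟩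
  obtain ⟨n, y, hy⟩ := nonempty_interior_of_iUnion_of_closed
    (fun n => (X n).isClosed_topologicalClosure) hU
  obtain ⟨ρ, hρ, hball⟩ := Metric.isOpen_iff.1 isOpen_interior y hy
  refine ⟨n, ρ, hρ, fun z hz hzρ ε hε => ?_⟩
  have hyz : y + ⟨z, hz⟩ ∈ (X n).topologicalClosure :=
    interior_subset (hball (by simpa [dist_eq_norm] using hzρ))
  have hmem : (⟨z, hz⟩ : Submodule.span K A) ∈ (X n).topologicalClosure := by
    simpa using (X n).topologicalClosure.sub_mem hyz (interior_subset hy)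
  obtain ⟨x, hxX, hx⟩ := Metric.mem_closure_iff.1 hmem ε hε
  exact ⟨x, (hX n x).1 hxX, by simpa [Subtype.dist_eq, dist_eq_norm] using hx⟩

/-- if `A` is a local compactoid in a non-archimedean normed space
and the span of `A` is infinite dimensional, then the span of `A` is not complete. -/
theorem statement15 {K : Type*} [NontriviallyNormedField K] [CompleteSpace K]
    [IsUltrametricDist K] {E : Type*} [NormedAddCommGroup E] [NormedSpace K E]
    [IsUltrametricDist E]
    (A : Set E) (hA : AbsolutelyConvex K A) (hloc : IsLocalCompactoid K A)
    (hinf : ¬ FiniteDimensional K (Submodule.span K A)) :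
    ¬ IsComplete (Submodule.span K A : Set E) := by

  intro hcomp
  obtain ⟨c, hc⟩ := NormedField.exists_one_lt_norm K
  have hc0 : 0 < ‖c‖ := one_pos.trans hc
  obtain ⟨n, ρ, hρ, hdense⟩ := hA.exists_ball_subset_closure hc hcomp
  set η : ℝ := ρ / ‖c‖ / ‖c‖ with hη
  have hη0 : 0 < η := by positivity
  obtain ⟨S, hS⟩ := hloc (Metric.ball 0 (η / ‖c‖ ^ n)) (Metric.ball_mem_nhds _ (by positivity))
  have hcn : c ^ n ≠ 0 := pow_ne_zero _ (norm_pos_iff.1 hc0)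
  have hball : ∀ z ∈ Submodule.span K A, ‖z‖ < ρ →
      ∃ d ∈ Submodule.span K (S : Set E), ‖z - d‖ < η := by
    intro z hz hzρ
    obtain ⟨x, hxA, hzx⟩ := hdense z hz hzρ η hη0
    obtain ⟨u, hu, w, hw, huw⟩ := Set.mem_add.1 (hS hxA)
    refine ⟨c ^ n • w, Submodule.smul_mem _ _ hw, ?_⟩
    have hx : x = c ^ n • u + c ^ n • w := by
      rw [← smul_add, huw, smul_smul, mul_inv_cancel₀ hcn, one_smul]
    have hzw : z - c ^ n • w = (z - x) + c ^ n • u := by rw [hx]; abel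
    have hcu : ‖c ^ n • u‖ < η := by
      rw [mem_ball_zero_iff, lt_div_iff₀ (by positivity)] at hu
      rw [norm_smul, norm_pow]
      linarith
    rw [hzw]
    exact (IsUltrametricDist.norm_add_le_max _ _).trans_lt (max_lt hzx hcu)
  have : FiniteDimensional K (Submodule.span K (S : Set E)) :=
    FiniteDimensional.span_finset K S
  refine hinf (finiteDimensional_of_approx (D := Submodule.span K (S : Set E))
    (inv_pos.2 hc0) (inv_lt_one_of_one_lt₀ hc) fun x hx => ?_)
  by_cases hx0 : x = 0
  · exact ⟨0, Submodule.zero_mem _, by simp [hx0]⟩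
  obtain ⟨a, ha0, haρ, hρa, -⟩ := rescale_to_shell hc hρ hx0
  obtain ⟨d, hd, had⟩ := hball (a • x) (Submodule.smul_mem _ _ hx) haρ
  refine ⟨a⁻¹ • d, Submodule.smul_mem _ _ hd, ?_⟩
  have hxd : a • x - d = a • (x - a⁻¹ • d) := by
    rw [smul_sub, smul_smul, mul_inv_cancel₀ ha0, one_smul]
  have h : ‖a‖ * ‖x - a⁻¹ • d‖ ≤ ‖a‖ * (‖c‖⁻¹ * ‖x‖) := by
    calc ‖a‖ * ‖x - a⁻¹ • d‖ = ‖a • x - d‖ := by rw [hxd, norm_smul]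
      _ ≤ ρ / ‖c‖ / ‖c‖ := had.le
      _ ≤ ‖a • x‖ / ‖c‖ := by gcongr
      _ = ‖a‖ * (‖c‖⁻¹ * ‖x‖) := by rw [norm_smul]; ring
  exact le_of_mul_le_mul_left h (norm_pos_iff.2 ha0)
end
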